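/- Let n be an even positive integer. The sum over all Hermitian self-dual codes C of length n over F_4 of the weight enumerator W_C(y) = Σ_{x∈C} y^{wt(x)} equals ∏_{i=0}^{n/2−1}(2^{2i+1}+1) + Σ_{j=1}^{n/2} C(n,2j)·3^{2j}·∏_{i=0}^{n/2−2}(2^{2i+1}+1)·y^{2j}, where C(n,2j) is the binomial coefficient. -/

import Mathlib

abbrev F4 := GaloisField 2 2

/-- Hermitian inner product on `F4^n`. -/
noncomputable def hIP {n : ℕ} (x y : Fin n → F4) : F4 := ∑ i, x i * (y i) ^ 2

/-- Hamming weight. -/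
noncomputable def wt {n : ℕ} (x : Fin n → F4) : ℕ := Nat.card {i : Fin n // x i ≠ 0}

/-- Hermitian dual code. -/
noncomputable def hDual {n : ℕ} (C : Submodule F4 (Fin n → F4)) : Submodule F4 (Fin n → F4) where
  carrier := {x | ∀ c ∈ C, hIP x c = 0}
  add_mem' := by
    intro a b ha hb c hc
    have h : hIP (a + b) c = hIP a c + hIP b c := by
      simp [hIP, add_mul, Finset.sum_add_distrib]
    simp only [h, ha c hc, hb c hc, add_zero]
  zero_mem' := by intro c hc; simp [hIP]
  smul_mem' := by
    intro r x hx c hc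
    have h : hIP (r • x) c = r * hIP x c := by
      simp [hIP, Finset.mul_sum, mul_assoc]
    simp only [h, hx c hc, mul_zero]

/-- Monomial transformation given by permutation `π` and nonzero scalars `s`. -/
noncomputable def monomialMap {n : ℕ} (π : Equiv.Perm (Fin n)) (s : Fin n → F4ˣ) :
    (Fin n → F4) →ₗ[F4] (Fin n → F4) where
  toFun x := fun i => (s i : F4) * x (π i)
  map_add' := by intro x y; funext i; simp [mul_add]
  map_smul' := by intro r x; funext i; simp [mul_comm, mul_left_comm]

/-- Monomial equivalence of codes. -/
noncomputable def CodeEquiv {n : ℕ} (C C' : Submodule F4 (Fin n → F4)) : Prop :=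
  ∃ (π : Equiv.Perm (Fin n)) (s : Fin n → F4ˣ), C.map (monomialMap π s) = C'

/-- Order of the automorphism group (monomial transformations preserving `C`). -/
noncomputable def autCard {n : ℕ} (C : Submodule F4 (Fin n → F4)) : ℕ :=
  Nat.card {p : Equiv.Perm (Fin n) × (Fin n → F4ˣ) // C.map (monomialMap p.1 p.2) = C}

/-- Direct sum of two codes. -/
noncomputable def dsum {n₁ n₂ : ℕ} (C₁ : Submodule F4 (Fin n₁ → F4)) (C₂ : Submodule F4 (Fin n₂ → F4)) :
    Submodule F4 (Fin (n₁ + n₂) → F4) :=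
  (C₁.comap (LinearMap.funLeft F4 F4 (Fin.castAdd n₂))) ⊓
    (C₂.comap (LinearMap.funLeft F4 F4 (Fin.natAdd n₁)))

section aux
theorem F4card : Nat.card F4 = 4 := by simp [GaloisField.card 2 2 (by norm_num)]
theorem F4pow (x : F4) : x ^ 4 = x := by
  have := Fintype.ofFinite F4
  have h := FiniteField.pow_card x
  rwa [← Nat.card_eq_fintype_card, F4card] at h
theorem F4two : (2 : F4) = 0 := CharP.cast_eq_zero F4 2
theorem F4add (x : F4) : x + x = 0 := CharTwo.add_self_eq_zero x
theorem F4cube (x : F4) (hx : x ≠ 0) : x ^ 3 = 1 := by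
  have h := F4pow x
  apply mul_left_cancel₀ hx
  linear_combination h

variable {n : ℕ}
theorem hIP_add_left (x y z : Fin n → F4) : hIP (x + y) z = hIP x z + hIP y z := by
  simp [hIP, add_mul, Finset.sum_add_distrib]
theorem hIP_smul_left (r : F4) (x z : Fin n → F4) : hIP (r • x) z = r * hIP x z := by
  simp [hIP, Finset.mul_sum, mul_assoc]
theorem hIP_conj (x y : Fin n → F4) : hIP y x = (hIP x y) ^ 2 := by
  simp only [hIP]
  rw [CharTwo.sum_sq]
  refine Finset.sum_congr rfl fun i _ => ?_
  rw [mul_pow, ← pow_mul, F4pow, mul_comm]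
theorem hIP_add_right (x y z : Fin n → F4) : hIP x (y + z) = hIP x y + hIP x z := by
  rw [hIP_conj, hIP_add_left, CharTwo.add_sq, ← hIP_conj, ← hIP_conj]
theorem hIP_smul_right (r : F4) (x z : Fin n → F4) : hIP x (r • z) = r ^ 2 * hIP x z := by
  rw [hIP_conj, hIP_smul_left, mul_pow, ← hIP_conj]
theorem hIP_self (x : Fin n → F4) : hIP x x = (wt x : F4) := by
  classical
  have : ∀ i, x i * x i ^ 2 = if x i ≠ 0 then 1 else 0 := by
    intro i
    split_ifs with h
    · rw [← F4cube _ h]; ring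
    · push Not at h; simp [h]
  simp only [hIP, this, wt]
  rw [Finset.sum_boole, Nat.card_eq_fintype_card, Fintype.card_subtype]
theorem iso_iff (x : Fin n → F4) : hIP x x = 0 ↔ Even (wt x) := by
  rw [hIP_self, CharP.cast_eq_zero_iff F4 2, even_iff_two_dvd]
theorem mem_hDual (C : Submodule F4 (Fin n → F4)) (x) : x ∈ hDual C ↔ ∀ c ∈ C, hIP x c = 0 := Iff.rfl

/-- transvection -/
noncomputable def trv (u : Fin n → F4) : (Fin n → F4) →ₗ[F4] (Fin n → F4) where
  toFun x := x + hIP x u • u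
  map_add' x y := by rw [hIP_add_left, add_smul]; abel
  map_smul' r x := by rw [hIP_smul_left, smul_add, mul_smul]; rfl
theorem trv_apply (u x : Fin n → F4) : trv u x = x + hIP x u • u := rfl
theorem trv_trv (u x : Fin n → F4) (hu : hIP u u = 0) : trv u (trv u x) = x := by
  simp only [trv_apply, hIP_add_left, hIP_smul_left, hu]
  rw [mul_zero, add_zero, add_assoc, ← add_smul, F4add, zero_smul, add_zero]
theorem trv_hIP (u x y : Fin n → F4) (hu : hIP u u = 0) : hIP (trv u x) (trv u y) = hIP x y := by
  simp only [trv_apply, hIP_add_left, hIP_smul_left, hIP_add_right, hIP_smul_right, hu]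
  rw [← hIP_conj y u]
  linear_combination hIP u y * hIP x u * F4two
theorem trv_dual (u : Fin n → F4) (hu : hIP u u = 0) (C : Submodule F4 (Fin n → F4)) (h : C = hDual C) :
    C.map (trv u) = hDual (C.map (trv u)) := by
  ext x
  rw [mem_hDual]
  constructor
  · rintro ⟨a, ha, rfl⟩ _ ⟨b, hb, rfl⟩
    rw [trv_hIP _ _ _ hu]
    have ha' : a ∈ hDual C := h ▸ ha
    exact ha' b hb
  · intro hx
    refine ⟨trv u x, ?_, trv_trv u x hu⟩
    have : trv u x ∈ hDual C := by
      intro c hc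
      rw [← trv_hIP u _ _ hu, trv_trv u x hu]
      exact hx _ ⟨c, hc, rfl⟩
    exact h ▸ this

/-- number of self-dual codes containing v -/
noncomputable def NN (v : Fin n → F4) : ℕ :=
  Set.ncard {C : Submodule F4 (Fin n → F4) | C = hDual C ∧ v ∈ C}

theorem NN_le (v w : Fin n → F4) (hv : hIP v v = 0) (hw : hIP w w = 0) (h : hIP v w = 1) :
    NN v ≤ NN w := by
  have h' : hIP w v = 1 := by rw [hIP_conj, h, one_pow]
  have hu : hIP (v + w) (v + w) = 0 := by
    simp [hIP_add_left, hIP_add_right, hv, hw, h, h', F4add]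
  have hvw : trv (v + w) v = w := by
    rw [trv_apply, hIP_add_right, hv, h, zero_add, one_smul, ← add_assoc]
    have : v + v = 0 := by ext i; exact F4add _
    rw [this, zero_add]
  refine Set.ncard_le_ncard_of_injOn (fun C => C.map (trv (v + w))) ?_ ?_ (Set.toFinite _)
  · rintro C ⟨hC, hvC⟩
    exact ⟨trv_dual _ hu C hC, ⟨v, hvC, hvw⟩⟩
  · intro C _ D _ hCD
    refine Submodule.map_injective_of_injective (f := trv (v + w)) ?_ hCD
    intro a b hab
    rw [← trv_trv _ a hu, hab, trv_trv _ b hu]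

theorem NN_smul (r : F4) (hr : r ≠ 0) (v : Fin n → F4) : NN (r • v) = NN v := by
  simp only [NN, Submodule.smul_mem_iff _ hr]

theorem NN_eq (v w : Fin n → F4) (hv : hIP v v = 0) (hw : hIP w w = 0) (h : hIP v w ≠ 0) :
    NN v = NN w := by
  rw [← NN_smul (hIP v w)⁻¹ (inv_ne_zero h)]
  have h1 : hIP ((hIP v w)⁻¹ • v) w = 1 := by rw [hIP_smul_left, inv_mul_cancel₀ h]
  have h2 : hIP ((hIP v w)⁻¹ • v) ((hIP v w)⁻¹ • v) = 0 := by
    rw [hIP_smul_left, hIP_smul_right, hv]; simp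
  refine le_antisymm (NN_le _ _ h2 hw h1) (NN_le _ _ hw h2 ?_)
  rw [hIP_conj, h1, one_pow]

/-- conjugate code -/
noncomputable def conjC (C : Submodule F4 (Fin n → F4)) : Submodule F4 (Fin n → F4) where
  carrier := {x | (fun i => x i ^ 2) ∈ C}
  add_mem' := by
    intro a b ha hb
    have := C.add_mem ha hb
    have h : (fun i => (a + b) i ^ 2) = (fun i => a i ^ 2) + (fun i => b i ^ 2) := by
      ext i; simp [CharTwo.add_sq]
    simpa only [Set.mem_ofPred_eq, h] using this
  zero_mem' := by
    have h : (fun i => (0 : Fin n → F4) i ^ 2) = 0 := by ext i; simp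
    simp only [Set.mem_ofPred_eq, h, C.zero_mem]
  smul_mem' := by
    intro r a ha
    have := C.smul_mem (r ^ 2) ha
    have h : (fun i => (r • a) i ^ 2) = r ^ 2 • (fun i => a i ^ 2) := by
      ext i; simp [mul_pow]
    simpa only [Set.mem_ofPred_eq, h] using this

theorem sq_sq (x : Fin n → F4) : (fun i => (x i ^ 2) ^ 2) = x := by
  ext i; rw [← pow_mul, F4pow]

theorem card_conjC (C : Submodule F4 (Fin n → F4)) : Nat.card (conjC C) = Nat.card C := by
  refine Nat.card_congr ⟨fun x => ⟨fun i => x.1 i ^ 2, x.2⟩, fun x => ⟨fun i => x.1 i ^ 2, ?_⟩, ?_, ?_⟩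
  · change (fun i => (x.1 i ^ 2) ^ 2) ∈ C
    rw [sq_sq]; exact x.2
  · intro x; exact Subtype.ext (sq_sq _)
  · intro x; exact Subtype.ext (sq_sq _)

theorem card_sub (C : Submodule F4 (Fin n → F4)) : Nat.card C = 4 ^ Module.finrank F4 C := by
  have := Fintype.ofFinite F4
  have := Fintype.ofFinite C
  rw [Nat.card_eq_fintype_card, Module.card_eq_pow_finrank (K := F4), ← Nat.card_eq_fintype_card (α := F4), F4card]

noncomputable def dotB (n : ℕ) : LinearMap.BilinForm F4 (Fin n → F4) := dotProductBilin F4 F4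

theorem dotB_nondeg : (dotB n).Nondegenerate := by
  have hs : (dotB n).IsSymm := ⟨fun x y => by simp [dotB, dotProduct_comm]⟩
  refine (LinearMap.IsRefl.nondegenerate_iff_separatingLeft hs.isRefl).2 ?_
  intro x hx
  ext i
  have := hx (Pi.single i 1)
  simpa [dotB] using this

theorem hDual_eq (C : Submodule F4 (Fin n → F4)) : hDual C = (dotB n).orthogonal (conjC C) := by
  ext x
  rw [mem_hDual, LinearMap.BilinForm.mem_orthogonal_iff]
  constructor
  · intro h y hy
    have := h _ hy
    change dotProduct y x = 0
    rw [← this, hIP, dotProduct_comm]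
    refine Finset.sum_congr rfl fun i _ => ?_
    rw [← pow_mul, F4pow]
  · intro h c hc
    have := h (fun i => c i ^ 2) (by change (fun i => (c i ^ 2) ^ 2) ∈ C; rw [sq_sq]; exact hc)
    have h2 : dotProduct (fun i => c i ^ 2) x = 0 := this
    rw [← h2, dotProduct_comm]; rfl

theorem card_selfdual (C : Submodule F4 (Fin n → F4)) (h : C = hDual C) : Nat.card C = 2 ^ n := by
  have h1 := LinearMap.BilinForm.finrank_orthogonal dotB_nondeg (conjC C)
  rw [← hDual_eq, ← h] at h1
  have h2 := card_conjC C
  rw [card_sub, card_sub] at h2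
  have h3 := Nat.pow_right_injective (le_refl 2 |>.trans (by norm_num : 2 ≤ 4)) h2
  have h4 := (conjC C).finrank_le
  rw [Module.finrank_fin_fun] at h1 h4
  rw [card_sub, show (4 : ℕ) = 2 ^ 2 by norm_num, ← pow_mul]
  congr 1
  omega

/-- number of self-dual codes -/
noncomputable def MM (n : ℕ) : ℕ := Set.ncard {C : Submodule F4 (Fin n → F4) | C = hDual C}

theorem NN_zero : NN (0 : Fin n → F4) = MM n := by simp [NN, MM]

theorem MM_zero : MM 0 = 1 := by
  have : {C : Submodule F4 (Fin 0 → F4) | C = hDual C} = {⊤} := by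
    ext C
    simp only [Set.mem_ofPred_eq, Set.mem_singleton_iff]
    have (D : Submodule F4 (Fin 0 → F4)) : D = ⊤ := by
      ext x; rw [Subsingleton.elim x 0]; exact iff_of_true D.zero_mem trivial
    rw [this C, this (hDual _)]
  rw [MM, this, Set.ncard_singleton]

theorem NN_odd (v : Fin n → F4) (h : ¬ Even (wt v)) : NN v = 0 := by
  rw [NN, Set.ncard_eq_zero]
  ext C
  simp only [Set.mem_ofPred_eq, Set.mem_empty_iff_false, iff_false]
  rintro ⟨hC, hv⟩
  have : v ∈ hDual C := hC ▸ hv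
  exact h ((iso_iff v).1 (this v hv))

section k
variable {k : ℕ}
/-- embed -/
noncomputable def emb (a b : F4) (y : Fin k → F4) : Fin (k + 2) → F4 := Fin.cons a (Fin.cons b y)

theorem hIP_emb (a b c d : F4) (x y : Fin k → F4) :
    hIP (emb a b x) (emb c d y) = a * c ^ 2 + (b * d ^ 2 + hIP x y) := by
  simp [hIP, emb, Fin.sum_univ_succ]

theorem emb_surj (x : Fin (k + 2) → F4) : ∃ a b y, x = emb a b y :=
  ⟨x 0, x 1, fun i => x i.succ.succ, by
    ext i
    refine Fin.cases ?_ (fun i => Fin.cases ?_ (fun i => ?_) i) i <;> simp [emb]⟩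

theorem emb_inj (a b c d : F4) (x y : Fin k → F4) : emb a b x = emb c d y ↔ a = c ∧ b = d ∧ x = y := by
  simp [emb]

theorem emb_add (a b c d : F4) (x y : Fin k → F4) : emb a b x + emb c d y = emb (a + c) (b + d) (x + y) := by
  ext i
  refine Fin.cases ?_ (fun i => Fin.cases ?_ (fun i => ?_) i) i <;> simp [emb]
theorem emb_smul (r a b : F4) (x : Fin k → F4) : r • emb a b x = emb (r * a) (r * b) (r • x) := by
  ext i
  refine Fin.cases ?_ (fun i => Fin.cases ?_ (fun i => ?_) i) i <;> simp [emb]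
theorem hIP_zero_left (y : Fin k → F4) : hIP 0 y = 0 := by simp [hIP]
theorem hIP_zero_right (y : Fin k → F4) : hIP y 0 = 0 := by simp [hIP]

noncomputable def ext2 (D : Submodule F4 (Fin k → F4)) : Submodule F4 (Fin (k + 2) → F4) where
  carrier := {x | ∃ a y, y ∈ D ∧ x = emb a a y}
  add_mem' := by
    rintro _ _ ⟨a, y, hy, rfl⟩ ⟨b, z, hz, rfl⟩
    exact ⟨a + b, y + z, D.add_mem hy hz, emb_add ..⟩
  zero_mem' := ⟨0, 0, D.zero_mem, by
    ext i
    refine Fin.cases ?_ (fun i => Fin.cases ?_ (fun i => ?_) i) i <;> simp [emb]⟩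
  smul_mem' := by
    rintro r _ ⟨a, y, hy, rfl⟩
    exact ⟨r * a, r • y, D.smul_mem r hy, emb_smul ..⟩

noncomputable def sh2 (C : Submodule F4 (Fin (k + 2) → F4)) : Submodule F4 (Fin k → F4) where
  carrier := {y | emb 0 0 y ∈ C}
  add_mem' := by
    intro y z hy hz
    have := C.add_mem hy hz
    rw [emb_add] at this
    simpa using this
  zero_mem' := by
    have h0 : emb 0 0 (0 : Fin k → F4) = 0 := by
      ext i
      refine Fin.cases ?_ (fun i => Fin.cases ?_ (fun i => ?_) i) i <;> simp [emb]
    change emb 0 0 (0 : Fin k → F4) ∈ C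
    rw [h0]; exact C.zero_mem
  smul_mem' := by
    intro r y hy
    have := C.smul_mem r hy
    rw [emb_smul] at this
    simpa using this

theorem mem_ext2 (D : Submodule F4 (Fin k → F4)) (a b y) : emb a b y ∈ ext2 D ↔ a = b ∧ y ∈ D := by
  constructor
  · rintro ⟨c, z, hz, h⟩
    rw [emb_inj] at h
    obtain ⟨rfl, rfl, rfl⟩ := h
    exact ⟨rfl, hz⟩
  · rintro ⟨rfl, hy⟩
    exact ⟨_, _, hy, rfl⟩
theorem mem_sh2 (C : Submodule F4 (Fin (k + 2) → F4)) (y) : y ∈ sh2 C ↔ emb 0 0 y ∈ C := Iff.rfl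

theorem ext2_dual (D : Submodule F4 (Fin k → F4)) (h : D = hDual D) : ext2 D = hDual (ext2 D) := by
  ext x
  obtain ⟨a, b, y, rfl⟩ := emb_surj x
  rw [mem_ext2, mem_hDual]
  constructor
  · rintro ⟨rfl, hy⟩ _ ⟨c, z, hz, rfl⟩
    have : y ∈ hDual D := h ▸ hy
    rw [hIP_emb, this z hz, add_zero, F4add]
  · intro hx
    have h1 := hx (emb 1 1 0) ((mem_ext2 ..).2 ⟨rfl, D.zero_mem⟩)
    rw [hIP_emb, hIP_zero_right] at h1
    refine ⟨CharTwo.add_eq_zero.1 (by simpa using h1), ?_⟩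
    rw [h]
    intro z hz
    have h2 := hx (emb 0 0 z) ((mem_ext2 ..).2 ⟨rfl, hz⟩)
    rw [hIP_emb] at h2
    simpa using h2

theorem ext2_sh2 (C : Submodule F4 (Fin (k + 2) → F4)) (h : C = hDual C) (he : emb 1 1 0 ∈ C) :
    ext2 (sh2 C) = C := by
  have key : ∀ a y, emb a a y ∈ C ↔ emb 0 0 y ∈ C := by
    intro a y
    have h1 : emb a a y = a • emb 1 1 0 + emb 0 0 y := by
      rw [emb_smul, emb_add]; simp
    rw [h1]
    exact Submodule.add_mem_iff_right _ (C.smul_mem a he)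
  ext x
  obtain ⟨a, b, y, rfl⟩ := emb_surj x
  rw [mem_ext2, mem_sh2]
  constructor
  · rintro ⟨rfl, hy⟩
    exact (key ..).2 hy
  · intro hx
    have hx' : emb a b y ∈ hDual C := h ▸ hx
    have h1 := hx' _ he
    rw [hIP_emb, hIP_zero_right] at h1
    have hab : a = b := CharTwo.add_eq_zero.1 (by simpa using h1)
    subst hab
    exact ⟨rfl, (key ..).1 hx⟩

theorem sh2_dual (C : Submodule F4 (Fin (k + 2) → F4)) (h : C = hDual C) (he : emb 1 1 0 ∈ C) :
    sh2 C = hDual (sh2 C) := by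
  ext y
  rw [mem_sh2, mem_hDual]
  constructor
  · intro hy d hd
    have hy' : emb 0 0 y ∈ hDual C := h ▸ hy
    have := hy' _ hd
    rw [hIP_emb] at this
    simpa using this
  · intro hy
    rw [h]
    intro c hc
    rw [← ext2_sh2 C h he] at hc
    obtain ⟨a, z, hz, rfl⟩ := hc
    rw [hIP_emb, hy z hz]
    simp

theorem NN_e : NN (emb 1 1 (0 : Fin k → F4)) = MM k := by
  symm
  refine Set.ncard_congr (fun D _ => ext2 D) ?_ ?_ ?_
  · intro D hD
    exact ⟨ext2_dual D hD, (mem_ext2 ..).2 ⟨rfl, D.zero_mem⟩⟩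
  · intro D D' _ _ h
    ext y
    have : emb 0 0 y ∈ ext2 D ↔ emb 0 0 y ∈ ext2 D' := by rw [h]
    simpa [mem_ext2] using this
  · rintro C ⟨hC, he⟩
    exact ⟨sh2 C, sh2_dual C hC he, ext2_sh2 C hC he⟩

theorem exists_om : ∃ a : F4, a ≠ 0 ∧ a ≠ 1 := by
  by_contra! h
  have h1 : (Set.univ : Set F4) ⊆ {0, 1} := by
    intro a _
    by_cases ha : a = 0
    · simp [ha]
    · simp [h a ha]
  have h2 := Set.ncard_le_ncard h1
  rw [Set.ncard_univ, F4card] at h2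
  have := Set.ncard_insert_le (0 : F4) {1}
  rw [Set.ncard_singleton] at this
  omega

theorem one_add_sq (a : F4) (h : a ≠ 1) : 1 + a ^ 2 ≠ 0 := by
  intro h'
  have : (1 + a) ^ 2 = 0 := by rw [CharTwo.add_sq, one_pow, h']
  have := pow_eq_zero_iff (two_ne_zero) |>.1 this
  exact h (CharTwo.add_eq_zero.1 this).symm

theorem NN_even (v : Fin (k + 2) → F4) (hv0 : v ≠ 0) (hv : Even (wt v)) : NN v = MM k := by
  rw [← NN_e]
  have hv := (iso_iff v).2 hv
  have hw : hIP (emb 1 1 (0 : Fin k → F4)) (emb 1 1 0) = 0 := by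
    rw [hIP_emb, hIP_zero_left]; simp [F4add]
  obtain ⟨a, b, y, rfl⟩ := emb_surj v
  by_cases hab : a = b
  · subst hab
    by_cases ha : a = 0
    · subst ha
      have : ∃ i, y i ≠ 0 := by
        by_contra! h
        apply hv0
        ext i
        refine Fin.cases ?_ (fun i => Fin.cases ?_ (fun i => ?_) i) i <;> simp [emb, h]
      obtain ⟨i, hi⟩ := this
      have hz : hIP (emb 1 0 (Pi.single i 1)) (emb 1 0 (Pi.single i (1 : F4))) = 0 := by
        rw [hIP_emb, hIP]
        simp [Pi.single_apply, F4add]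
      trans NN (emb 1 0 (Pi.single i (1 : F4)))
      · refine NN_eq _ _ hv hz ?_
        rw [hIP_emb, hIP]
        simpa [Pi.single_apply] using hi
      · refine NN_eq _ _ hz hw ?_
        rw [hIP_emb, hIP_zero_right]; simp
    · obtain ⟨o, ho, ho1⟩ := exists_om
      have hz : hIP (emb 1 o (0 : Fin k → F4)) (emb 1 o 0) = 0 := by
        rw [hIP_emb, hIP_zero_left]
        have := F4cube o ho
        linear_combination this + F4two
      trans NN (emb 1 o (0 : Fin k → F4))
      · refine NN_eq _ _ hv hz ?_
        rw [hIP_emb, hIP_zero_right]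
        have := mul_ne_zero ha (one_add_sq o ho1)
        intro h; apply this; rw [← h]; ring
      · refine NN_eq _ _ hz hw ?_
        rw [hIP_emb, hIP_zero_right]
        simp only [one_pow, mul_one, add_zero]
        intro h
        exact ho1 (CharTwo.add_eq_zero.1 h).symm
  · refine NN_eq _ _ hv hw ?_
    rw [hIP_emb, hIP_zero_right]
    simp only [one_pow, mul_one, add_zero]
    intro h
    exact hab (CharTwo.add_eq_zero.1 h)
end k

noncomputable instance F4fin : Fintype F4 := Fintype.ofFinite _

open Polynomial in
theorem genfun : ∑ x : Fin n → F4, (X : ℤ[X]) ^ wt x = (3 * X + 1) ^ n := by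
  classical
  have h1 : (3 * X + 1 : ℤ[X]) = ∑ a : F4, if a ≠ 0 then X else 1 := by
    rw [Finset.sum_ite]
    have e1 : (Finset.univ.filter fun a : F4 => ¬ a ≠ 0) = {0} := by ext; simp
    have e2 : (Finset.univ.filter fun a : F4 => a ≠ 0) = Finset.univ.erase 0 := by ext; simp
    rw [e1, e2, Finset.sum_const, Finset.sum_const, Finset.card_erase_of_mem (Finset.mem_univ _),
      Finset.card_univ, ← Nat.card_eq_fintype_card, F4card]
    simp
  rw [h1, Fintype.sum_pow]
  refine Finset.sum_congr rfl fun x _ => ?_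
  rw [Finset.prod_ite, wt, Nat.card_eq_fintype_card, Fintype.card_subtype]
  simp

open Polynomial in
theorem wcount (k : ℕ) : ((Finset.univ.filter fun x : Fin n → F4 => wt x = k).card : ℤ) = n.choose k * 3 ^ k := by
  have h := congrArg (fun p => p.coeff k) (genfun (n := n))
  simp only [finsetSum_coeff, coeff_X_pow] at h
  have h2 : ((3 * X + 1) ^ n : ℤ[X]).coeff k = n.choose k * 3 ^ k := by
    have : (3 * X + 1 : ℤ[X]) ^ n = ((X + 1) ^ n).comp (C 3 * X) := by simp
    rw [this, comp_C_mul_X_coeff, coeff_X_add_one_pow]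
  rw [h2] at h
  rw [← h]
  simp [eq_comm]

theorem wt_le (x : Fin n → F4) : wt x ≤ n := by
  classical
  rw [wt, Nat.card_eq_fintype_card]
  simpa using Fintype.card_subtype_le (fun i => x i ≠ 0)

theorem wt_eq_zero (x : Fin n → F4) : wt x = 0 ↔ x = 0 := by
  classical
  rw [wt, Nat.card_eq_fintype_card, Fintype.card_eq_zero_iff, isEmpty_subtype]
  simp [funext_iff]

open Polynomial in
theorem wsum (f : ℕ → ℤ[X]) : ∑ x : Fin n → F4, f (wt x) =
    ∑ k ∈ Finset.range (n + 1), C ((n.choose k * 3 ^ k : ℤ)) * f k := by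
  rw [← Finset.sum_fiberwise_of_maps_to (g := wt) (t := Finset.range (n + 1))
    (fun x _ => Finset.mem_range.2 (Nat.lt_succ_of_le (wt_le x)))]
  refine Finset.sum_congr rfl fun k _ => ?_
  rw [← wcount, Finset.sum_congr rfl (g := fun _ => f k), Finset.sum_const]
  · simp
  · intro x hx
    rw [(Finset.mem_filter.1 hx).2]

open Polynomial in
theorem swap : (∑ᶠ C ∈ {C : Submodule F4 (Fin n → F4) | C = hDual C},
        ∑ᶠ x ∈ (C : Set (Fin n → F4)), (X : Polynomial ℤ) ^ wt x) =
    ∑ x : Fin n → F4, (NN x : ℤ[X]) * X ^ wt x := by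
  classical
  rw [finsum_mem_eq_finite_toFinset_sum _ (Set.toFinite _)]
  have h1 : ∀ D : Submodule F4 (Fin n → F4), ∑ᶠ x ∈ (D : Set (Fin n → F4)), (X : Polynomial ℤ) ^ wt x
      = ∑ x : Fin n → F4, if x ∈ D then X ^ wt x else 0 := by
    intro D
    rw [finsum_mem_eq_finite_toFinset_sum _ (Set.toFinite _), ← Finset.sum_filter]
    refine Finset.sum_congr ?_ fun _ _ => rfl
    ext; simp
  simp only [h1]
  rw [Finset.sum_comm]
  refine Finset.sum_congr rfl fun x _ => ?_
  rw [← Finset.sum_filter, Finset.sum_const, nsmul_eq_mul, NN]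
  congr 2
  rw [← Set.ncard_coe_finset]
  congr 1
  ext; simp

open Polynomial in
theorem eval_swap : eval (1 : ℤ) (∑ x : Fin n → F4, (NN x : ℤ[X]) * X ^ wt x) = (2 : ℤ) ^ n * (MM n : ℤ) := by
  classical
  rw [← swap, finsum_mem_eq_finite_toFinset_sum _ (Set.toFinite _), eval_finsetSum,
    Finset.sum_congr rfl (g := fun _ => (2 : ℤ) ^ n), Finset.sum_const, MM, Set.ncard_eq_toFinset_card _ (Set.toFinite _)]
  · simp [mul_comm]
  · intro D hD
    have hD : D = hDual D := by simpa using hD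
    rw [finsum_mem_eq_finite_toFinset_sum _ (Set.toFinite _), eval_finsetSum]
    have := card_selfdual D hD
    simp only [eval_pow, eval_X, one_pow, Finset.sum_const, nsmul_eq_mul, mul_one]
    rw [← Set.ncard_eq_toFinset_card, ← Nat.card_coe_set_eq]
    exact_mod_cast this

theorem sum_evens {A : Type*} [AddCommMonoid A] (F : ℕ → A) (hF : ∀ j, ¬ Even j → F j = 0) (m : ℕ) :
    ∑ j ∈ Finset.range (2 * m + 1), F j = F 0 + ∑ j ∈ Finset.Icc 1 m, F (2 * j) := by
  induction m with
  | zero => simp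
  | succ m ih =>
    rw [show 2 * (m + 1) + 1 = 2 * m + 1 + 1 + 1 by ring, Finset.sum_range_succ, Finset.sum_range_succ,
      ih, Finset.sum_Icc_succ_top (by omega), hF (2 * m + 1) (by simp), add_zero, add_assoc]
    rfl

open Polynomial in
theorem main_sum (m : ℕ) : ∑ x : Fin (2 * m + 2) → F4, (NN x : ℤ[X]) * X ^ wt x =
    C (MM (2 * m + 2) : ℤ) + ∑ j ∈ Finset.Icc 1 (m + 1),
      C (((2 * m + 2).choose (2 * j) * 3 ^ (2 * j) * MM (2 * m) : ℤ)) * X ^ (2 * j) := by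
  have h : ∀ x : Fin (2 * m + 2) → F4, (NN x : ℤ[X]) * X ^ wt x =
      (fun j => ((if j = 0 then MM (2 * m + 2) else if Even j then MM (2 * m) else 0 : ℕ) : ℤ[X]) * X ^ j) (wt x) := by
    intro x
    simp only
    split_ifs with h1 h2
    · rw [(wt_eq_zero x).1 h1, NN_zero]
    · rw [NN_even x (fun h => h1 ((wt_eq_zero x).2 h)) h2]
    · rw [NN_odd x h2]
  rw [Finset.sum_congr rfl fun x _ => h x, wsum (fun j => ((if j = 0 then MM (2 * m + 2) else if Even j then MM (2 * m) else 0 : ℕ) : ℤ[X]) * X ^ j), show 2 * m + 2 + 1 = 2 * (m + 1) + 1 by ring, sum_evens]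
  · congr 1
    · simp
    · refine Finset.sum_congr rfl fun j hj => ?_
      have := (Finset.mem_Icc.1 hj).1
      rw [if_neg (by omega), if_pos (by simp)]
      simp [mul_assoc]
  · intro j hj
    rw [if_neg (by rintro rfl; simp at hj), if_neg hj]
    simp

theorem evens_val (m : ℕ) : 2 * (1 + ∑ j ∈ Finset.Icc 1 m, ((2 * m).choose (2 * j) * 3 ^ (2 * j) : ℤ)) = 16 ^ m + 4 ^ m := by
  have h1 := add_pow (3 : ℤ) 1 (2 * m)
  have h2 := add_pow (-3 : ℤ) 1 (2 * m)
  have h3 := sum_evens (fun j => (3 : ℤ) ^ j * 1 ^ (2 * m - j) * (2 * m).choose j +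
    (-3 : ℤ) ^ j * 1 ^ (2 * m - j) * (2 * m).choose j) (by
      intro j hj
      rw [Odd.neg_pow (Nat.not_even_iff_odd.1 hj)]; ring) m
  rw [Finset.sum_add_distrib, ← h1, ← h2] at h3
  norm_num [pow_mul] at h3
  rw [h3, mul_add, Finset.mul_sum]
  congr 1
  refine Finset.sum_congr rfl fun j _ => ?_
  rw [pow_mul]; norm_num; ring

theorem MM_rec (m : ℕ) : (MM (2 * m + 2) : ℤ) = (2 ^ (2 * m + 1) + 1) * MM (2 * m) := by
  have h := eval_swap (n := 2 * m + 2)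
  rw [main_sum] at h
  simp only [Polynomial.eval_add, Polynomial.eval_C, Polynomial.eval_finsetSum, Polynomial.eval_mul,
    Polynomial.eval_pow, Polynomial.eval_X, one_pow, mul_one] at h
  rw [← Finset.sum_mul] at h
  have h2 := evens_val (m + 1)
  rw [show 2 * (m + 1) = 2 * m + 2 by ring] at h2
  have e1 : (2 : ℤ) ^ (2 * m + 2) = 4 * 4 ^ m := by rw [pow_add, pow_mul]; norm_num; ring
  have e2 : (2 : ℤ) ^ (2 * m + 1) = 2 * 4 ^ m := by rw [pow_add, pow_mul]; norm_num; ring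
  have e3 : (16 : ℤ) ^ (m + 1) = 16 * (4 ^ m) ^ 2 := by
    rw [← pow_mul, mul_comm m 2, pow_mul, pow_succ]; norm_num; ring
  rw [e1] at h
  rw [e3, pow_succ (4 : ℤ) m] at h2
  rw [e2]
  have hp : (1 : ℤ) ≤ 4 ^ m := one_le_pow₀ (by norm_num)
  generalize (4 : ℤ) ^ m = q at *
  have hq : 2 * (4 * q - 1) ≠ 0 := by omega
  apply mul_left_cancel₀ hq
  linear_combination (-2) * h + (MM (2 * m) : ℤ) * h2

theorem MM_val (m : ℕ) : (MM (2 * m) : ℤ) = ∏ i ∈ Finset.range m, (2 ^ (2 * i + 1) + 1) := by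
  induction m with
  | zero => simp [MM_zero]
  | succ m ih => rw [Finset.prod_range_succ, ← ih, mul_comm (MM (2 * m) : ℤ), ← MM_rec]; rfl

end aux

open Polynomial in
/-- Mass formula for weight enumerators: the sum over all Hermitian self-dual
codes `C` of length `n` of `W_C(y) = Σ_{x ∈ C} y^{wt x}` equals
`∏_{i=0}^{n/2-1}(2^{2i+1}+1) + Σ_{j=1}^{n/2} C(n,2j)·3^{2j}·∏_{i=0}^{n/2-2}(2^{2i+1}+1)·y^{2j}`. -/
theorem stmt8 {n : ℕ} (hn : 0 < n) (hne : Even n) :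
    (∑ᶠ C ∈ {C : Submodule F4 (Fin n → F4) | C = hDual C},
        ∑ᶠ x ∈ (C : Set (Fin n → F4)), (X : Polynomial ℤ) ^ wt x) =
      C ((∏ i ∈ Finset.range (n / 2), (2 ^ (2 * i + 1) + 1) : ℤ)) +
        ∑ j ∈ Finset.Icc 1 (n / 2),
          C ((n.choose (2 * j) * 3 ^ (2 * j) *
              ∏ i ∈ Finset.range (n / 2 - 1), (2 ^ (2 * i + 1) + 1) : ℤ)) *
            (X : Polynomial ℤ) ^ (2 * j) := by

  obtain ⟨m, rfl⟩ : ∃ m, n = 2 * m + 2 := by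
    obtain ⟨r, rfl⟩ := hne
    exact ⟨r - 1, by omega⟩
  rw [swap, main_sum, show 2 * m + 2 = 2 * (m + 1) by ring, MM_val, MM_val,
    Nat.mul_div_cancel_left _ (by norm_num : 0 < 2), Nat.add_sub_cancel]
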